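/- Let G be a digraph with transitive closure Ḡ, let f̄ be a discrete Morse function on Ḡ, and let V̄ = grad f̄ and Φ̄ = Id + ∂V̄ + V̄∂ be the discrete gradient vector field and gradient flow on Ḡ. Suppose Φ̄(α) ∈ Ω(G) for every allowed elementary path α on G that is critical in Ḡ. Then for each n ≥ 0 the linear map sending α to α + V̄∂(α), defined on the span Crit_n(Ḡ) ∩ P_n(G) of the n-paths that are critical in Ḡ and allowed in G, is an ℝ-linear isomorphism onto P_n^Φ̄(Ḡ) ∩ Ω_n(G). -/

import Mathlib

open scoped BigOperators Classical

namespace PathMorse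

/-- A digraph: an irreflexive edge relation on a vertex set. -/
structure Digraph (V : Type) where
  E : V → V → Prop
  irrefl : ∀ v, ¬ E v v

/-- A digraph is transitive if `u→v` and `v→w` imply `u→w`. -/
def Digraph.Transitive {V : Type} (G : Digraph V) : Prop :=
  ∀ u v w, G.E u v → G.E v w → G.E u w

/-- `Gbar` is the transitive closure of `G`: the smallest transitive digraph containing `G`. -/
def IsTransClosure {V : Type} (G Gbar : Digraph V) : Prop :=
  Gbar.Transitive ∧ (∀ u v, G.E u v → Gbar.E u v) ∧
    ∀ H : Digraph V, H.Transitive → (∀ u v, G.E u v → H.E u v) →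
      ∀ u v, Gbar.E u v → H.E u v

/-- An elementary `n`-path on `V`: a sequence of `n+1` vertices. -/
abbrev Path (V : Type) (n : ℕ) := Fin (n+1) → V

/-- An elementary path is allowed on `G` if consecutive vertices are joined by directed edges. -/
def Allowed {V : Type} (G : Digraph V) {n : ℕ} (p : Path V n) : Prop :=
  ∀ i : Fin n, G.E (p i.castSucc) (p i.succ)

/-- The `i`-th face of a path: delete the `i`-th vertex. -/
def face {V : Type} {n : ℕ} (i : Fin (n+2)) (p : Path V (n+1)) : Path V n :=
  p ∘ i.succAbove

/-- `q` is obtained from `p` by deleting one vertex (the codimension-one relation `q < p`). -/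
def IsFace {V : Type} {n : ℕ} (q : Path V n) (p : Path V (n+1)) : Prop :=
  ∃ i : Fin (n+2), face i p = q

/-- Value of `f` on a path: sum of the values at the vertices. -/
def fPath {V : Type} (f : V → ℝ) {n : ℕ} (p : Path V n) : ℝ :=
  ∑ i, f (p i)

/-- There is an allowed coface `γ > p` with `f γ = f p`. -/
def HasEqualCoface {V : Type} (G : Digraph V) (f : V → ℝ) {n : ℕ} (p : Path V n) : Prop :=
  ∃ γ : Path V (n+1), Allowed G γ ∧ IsFace p γ ∧ fPath f γ = fPath f p

/-- There is an allowed face `β < p` with `f β = f p`. -/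
def HasEqualFace {V : Type} (G : Digraph V) (f : V → ℝ) : (n : ℕ) → Path V n → Prop
  | 0, _ => False
  | (n+1), p => ∃ β : Path V n, Allowed G β ∧ IsFace β p ∧ fPath f β = fPath f p

/-- A discrete Morse function on a digraph: nonnegative, and for each allowed elementary path
there is at most one allowed coface with the same value, and at most one allowed face with the
same value. -/
def IsMorse {V : Type} (G : Digraph V) (f : V → ℝ) : Prop :=
  (∀ v, 0 ≤ f v) ∧
  (∀ n (α : Path V n), Allowed G α →
    ∀ γ₁ γ₂ : Path V (n+1), Allowed G γ₁ → Allowed G γ₂ → IsFace α γ₁ → IsFace α γ₂ →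
      fPath f γ₁ = fPath f α → fPath f γ₂ = fPath f α → γ₁ = γ₂) ∧
  (∀ n (α : Path V (n+1)), Allowed G α →
    ∀ β₁ β₂ : Path V n, Allowed G β₁ → Allowed G β₂ → IsFace β₁ α → IsFace β₂ α →
      fPath f β₁ = fPath f α → fPath f β₂ = fPath f α → β₁ = β₂)

/-- A critical path: allowed, with no allowed coface of equal value, no allowed face of equal value. -/
def IsCritical {V : Type} (G : Digraph V) (f : V → ℝ) {n : ℕ} (p : Path V n) : Prop :=
  Allowed G p ∧ ¬ HasEqualCoface G f p ∧ ¬ HasEqualFace G f n p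

/-- `n`-chains: the real vector space with (orthonormal) basis the elementary `n`-paths. -/
abbrev Chain (V : Type) (n : ℕ) := Path V n → ℝ

variable {V : Type} [Fintype V] [DecidableEq V]

/-- The basis chain corresponding to an elementary path. -/
def unitP {n : ℕ} (p : Path V n) : Chain V n := Pi.single p 1

/-- The boundary operator on chains (as a bare function). -/
def boundaryFun {n : ℕ} (x : Chain V (n+1)) : Chain V n :=
  fun q => ∑ p : Path V (n+1), x p * ∑ i : Fin (n+2), ((-1:ℝ)^(i:ℕ)) * (if face i p = q then 1 else 0)

/-- The boundary operator `∂ = Σ (-1)^i d_i` as a linear map. -/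
def boundary (V : Type) [Fintype V] [DecidableEq V] (n : ℕ) : Chain V (n+1) →ₗ[ℝ] Chain V n where
  toFun := boundaryFun
  map_add' x y := by
    funext q
    simp [boundaryFun, add_mul, Finset.sum_add_distrib]
  map_smul' c x := by
    funext q
    simp [boundaryFun, Finset.mul_sum, mul_assoc]

/-- `P_n(G)`: the span of the allowed elementary `n`-paths. -/
def pSpan (G : Digraph V) (n : ℕ) : Submodule ℝ (Chain V n) :=
  Submodule.span ℝ {x : Chain V n | ∃ p : Path V n, Allowed G p ∧ x = unitP p}

/-- `Ω_n(G) = {x ∈ P_n(G) : ∂x ∈ P_{n-1}(G)}` (with `Ω_0 = P_0`). -/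
def omega (G : Digraph V) : (n : ℕ) → Submodule ℝ (Chain V n)
  | 0 => pSpan G 0
  | (n+1) => pSpan G (n+1) ⊓ (pSpan G n).comap (boundary V n)

/-- The discrete gradient vector field on a basis path: `V(α) = -⟨∂γ,α⟩ γ` if there is an
allowed coface `γ > α` with `f γ = f α`, and `0` otherwise. -/
noncomputable def gradFun (G : Digraph V) (f : V → ℝ) {n : ℕ} (α : Path V n) : Chain V (n+1) :=
  if h : Allowed G α ∧ ∃ γ : Path V (n+1), Allowed G γ ∧ IsFace α γ ∧ fPath f γ = fPath f α then
    (-(boundary V n (unitP h.2.choose) α)) • unitP h.2.choose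
  else 0

/-- The discrete gradient vector field `V = grad f`, extended linearly to chains. -/
noncomputable def grad (G : Digraph V) (f : V → ℝ) (n : ℕ) : Chain V n →ₗ[ℝ] Chain V (n+1) where
  toFun x := ∑ α : Path V n, x α • gradFun G f α
  map_add' x y := by simp [add_smul, Finset.sum_add_distrib]
  map_smul' c x := by simp [Finset.smul_sum, smul_smul]

/-- The composite `V∂` in degree `n` (zero in degree `0`). -/
noncomputable def vd (G : Digraph V) (f : V → ℝ) : (n : ℕ) → (Chain V n →ₗ[ℝ] Chain V n)
  | 0 => 0
  | (n+1) => (grad G f n).comp (boundary V n)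

/-- The discrete gradient flow `Φ = Id + ∂V + V∂`. -/
noncomputable def flow (G : Digraph V) (f : V → ℝ) (n : ℕ) : Chain V n →ₗ[ℝ] Chain V n :=
  LinearMap.id + (boundary V n).comp (grad G f n) + vd G f n

/-- `P_n^Φ(G) = {x ∈ P_n(G) : Φ x = x}`. -/
noncomputable def pPhi (G : Digraph V) (f : V → ℝ) (n : ℕ) : Submodule ℝ (Chain V n) :=
  pSpan G n ⊓ LinearMap.ker (flow G f n - LinearMap.id)

/-- The cycles of a chain complex of subspaces `C` with differentials `D`
(in degree `0`, everything is a cycle). -/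
def cycles (C : ∀ n, Submodule ℝ (Chain V n)) (D : ∀ n, Chain V (n+1) →ₗ[ℝ] Chain V n) :
    (m : ℕ) → Submodule ℝ (Chain V m)
  | 0 => C 0
  | (m+1) => C (m+1) ⊓ LinearMap.ker (D m)

/-- Homology of the chain complex `(C, D)`: cycles modulo boundaries coming from `C`. -/
abbrev Homology (C : ∀ n, Submodule ℝ (Chain V n)) (D : ∀ n, Chain V (n+1) →ₗ[ℝ] Chain V n)
    (m : ℕ) :=
  (cycles C D m) ⧸ (Submodule.comap (cycles C D m).subtype ((C (m+1)).map (D m)))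

/-- The operator `e^{tf}` on chains. -/
noncomputable def expOp (f : V → ℝ) (t : ℝ) (n : ℕ) : Chain V n →ₗ[ℝ] Chain V n where
  toFun x := fun p => Real.exp (t * fPath f p) * x p
  map_add' x y := by funext p; simp [mul_add]
  map_smul' c x := by funext p; simp; ring

/-- The deformed boundary `∂_t = e^{tf} ∂ e^{-tf}`. -/
noncomputable def dT (f : V → ℝ) (t : ℝ) (n : ℕ) : Chain V (n+1) →ₗ[ℝ] Chain V n :=
  (expOp f t n).comp ((boundary V n).comp (expOp f (-t) (n+1)))

/-- The span of the elementary `n`-paths that are critical in `Gbar` and allowed in `G`. -/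
def critSpan (G Gbar : Digraph V) (f : V → ℝ) (n : ℕ) : Submodule ℝ (Chain V n) :=
  Submodule.span ℝ {x : Chain V n | ∃ α : Path V n, IsCritical Gbar f α ∧ Allowed G α ∧ x = unitP α}

/-- A span of basis chains consists of the chains supported on the chosen paths. -/
lemma mem_span_unitP_iff {V : Type} [Fintype V] [DecidableEq V] {n : ℕ} (S : Path V n → Prop)
    {s : Set (Chain V n)} (hs : ∀ x, x ∈ s ↔ ∃ p, S p ∧ x = unitP p) (x : Chain V n) :
    x ∈ Submodule.span ℝ s ↔ ∀ p, x p ≠ 0 → S p := by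
  constructor
  · intro hx
    induction hx using Submodule.span_induction with
    | mem x hx =>
      obtain ⟨q, hq, rfl⟩ := (hs x).1 hx
      intro p hp
      by_cases h : p = q
      · exact h ▸ hq
      · simp [unitP, h] at hp
    | zero => simp
    | add x y _ _ hx hy =>
      intro p hp
      by_cases h : x p = 0
      · exact hy p fun h' => hp (by simp [h, h'])
      · exact hx p h
    | smul c x _ hx =>
      intro p hp
      exact hx p fun h => hp (by simp [h])
  · intro h
    have hx : x = ∑ p, x p • unitP p := by
      funext q
      simp [unitP, Finset.sum_apply, Pi.single_apply]
    rw [hx]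
    refine Submodule.sum_mem _ fun p _ => ?_
    by_cases hp : x p = 0
    · simp [hp]
    · exact Submodule.smul_mem _ _ (Submodule.subset_span ((hs _).2 ⟨p, h p hp, rfl⟩))

lemma mem_pSpan_iff {V : Type} [Fintype V] [DecidableEq V] (G : Digraph V) {n : ℕ}
    (x : Chain V n) : x ∈ pSpan G n ↔ ∀ p, x p ≠ 0 → Allowed G p :=
  mem_span_unitP_iff _ (fun _ => Iff.rfl) x

lemma mem_critSpan_iff {V : Type} [Fintype V] [DecidableEq V] (G Gbar : Digraph V) (f : V → ℝ)
    {n : ℕ} (x : Chain V n) :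
    x ∈ critSpan G Gbar f n ↔ ∀ p, x p ≠ 0 → IsCritical Gbar f p ∧ Allowed G p :=
  mem_span_unitP_iff (fun p => IsCritical Gbar f p ∧ Allowed G p)
    (fun x => by simp only [Set.mem_ofPred_eq, and_assoc]) x

lemma omega_le_pSpan {V : Type} [Fintype V] [DecidableEq V] (G : Digraph V) (n : ℕ) :
    omega G n ≤ pSpan G n := by
  cases n with
  | zero => exact le_rfl
  | succ n => exact inf_le_left

lemma fPath_eq_add_face {V : Type} (f : V → ℝ) {n : ℕ} (i : Fin (n + 2)) (p : Path V (n + 1)) :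
    fPath f p = f (p i) + fPath f (face i p) := by
  simp [fPath, face, Fin.sum_univ_succAbove _ i]

lemma fPath_eq_face_iff {V : Type} (f : V → ℝ) {n : ℕ} (i : Fin (n + 2)) (p : Path V (n + 1)) :
    fPath f p = fPath f (face i p) ↔ f (p i) = 0 := by
  rw [fPath_eq_add_face f i p]
  simp

lemma Allowed.edge_of_lt {V : Type} {G : Digraph V} (hG : G.Transitive) {n : ℕ} {p : Path V n}
    (hp : Allowed G p) {i j : Fin (n + 1)} (hij : i < j) : G.E (p i) (p j) := by
  induction j using Fin.induction with
  | zero => exact absurd hij (Fin.not_lt_zero i)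
  | succ j ih =>
    rcases (Fin.le_castSucc_iff.2 hij).eq_or_lt with h | h
    · exact h ▸ hp j
    · exact hG _ _ _ (ih h) (hp j)

lemma Allowed.face {V : Type} {G : Digraph V} (hG : G.Transitive) {n : ℕ} {p : Path V (n + 1)}
    (hp : Allowed G p) (i : Fin (n + 2)) : Allowed G (face i p) := fun _ =>
  hp.edge_of_lt hG (Fin.strictMono_succAbove i Fin.castSucc_lt_succ)

lemma not_edge_of_eq_zero {V : Type} {G : Digraph V} {f : V → ℝ} (hf : IsMorse G f) {u v : V}
    (hu : f u = 0) (hv : f v = 0) : ¬ G.E u v := by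
  intro h
  have hall : Allowed G (![u, v] : Path V 1) := by
    intro i
    fin_cases i
    exact h
  have key := hf.2.2 0 ![u, v] hall (face 0 ![u, v]) (face 1 ![u, v])
    (fun i => i.elim0) (fun i => i.elim0) ⟨0, rfl⟩ ⟨1, rfl⟩
    ((fPath_eq_face_iff f 0 _).2 hu).symm ((fPath_eq_face_iff f 1 _).2 hv).symm
  have huv : v = u := by simpa [face, Fin.succAbove] using congrFun key 0
  exact G.irrefl u (huv ▸ h)

lemma Allowed.eq_of_eq_zero {V : Type} {G : Digraph V} {f : V → ℝ} (hG : G.Transitive)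
    (hf : IsMorse G f) {n : ℕ} {p : Path V n} (hp : Allowed G p) {i j : Fin (n + 1)}
    (hi : f (p i) = 0) (hj : f (p j) = 0) : i = j := by
  rcases lt_trichotomy i j with h | h | h
  · exact absurd (hp.edge_of_lt hG h) (not_edge_of_eq_zero hf hi hj)
  · exact h
  · exact absurd (hp.edge_of_lt hG h) (not_edge_of_eq_zero hf hj hi)

/-- An allowed path meeting the zero set of `f` has no equal coface. -/
lemma not_hasEqualCoface_of_eq_zero {V : Type} {G : Digraph V} {f : V → ℝ} (hG : G.Transitive)
    (hf : IsMorse G f) {n : ℕ} {p : Path V n} {i : Fin (n + 1)} (hi : f (p i) = 0) :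
    ¬ HasEqualCoface G f p := by
  rintro ⟨γ, hγ, ⟨j, rfl⟩, h⟩
  exact Fin.succAbove_ne j i (hγ.eq_of_eq_zero hG hf hi ((fPath_eq_face_iff f j γ).1 h))

lemma boundary_unitP {V : Type} [Fintype V] [DecidableEq V] {n : ℕ} (γ : Path V (n + 1)) :
    boundary V n (unitP γ) = ∑ i : Fin (n + 2), ((-1 : ℝ) ^ (i : ℕ)) • unitP (face i γ) := by
  funext q
  change boundaryFun (unitP γ) q = _
  simp [boundaryFun, unitP, Pi.single_apply, eq_comm]

lemma grad_unitP {V : Type} [Fintype V] [DecidableEq V] (G : Digraph V) (f : V → ℝ) {n : ℕ}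
    (α : Path V n) : grad G f n (unitP α) = gradFun G f α := by
  change ∑ β, unitP α β • gradFun G f β = _
  simp [unitP, Pi.single_apply]

lemma gradFun_eq_zero {V : Type} [Fintype V] [DecidableEq V] {G : Digraph V} {f : V → ℝ} {n : ℕ}
    {α : Path V n} (h : ¬ HasEqualCoface G f α) : gradFun G f α = 0 :=
  dif_neg fun h' => h h'.2

lemma gradFun_face {V : Type} [Fintype V] [DecidableEq V] {G : Digraph V} {f : V → ℝ}
    (hG : G.Transitive) (hf : IsMorse G f) {n : ℕ} {γ : Path V (n + 1)} (hγ : Allowed G γ)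
    {i : Fin (n + 2)} (hi : f (γ i) = 0) :
    gradFun G f (face i γ) = (-(-1 : ℝ) ^ (i : ℕ)) • unitP γ := by
  have h : Allowed G (face i γ) ∧ ∃ δ : Path V (n + 1), Allowed G δ ∧ IsFace (face i γ) δ ∧
      fPath f δ = fPath f (face i γ) :=
    ⟨hγ.face hG i, γ, hγ, ⟨i, rfl⟩, (fPath_eq_face_iff f i γ).2 hi⟩
  have hc : h.2.choose = γ :=
    hf.2.1 n (face i γ) h.1 _ γ h.2.choose_spec.1 hγ h.2.choose_spec.2.1 ⟨i, rfl⟩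
      h.2.choose_spec.2.2 ((fPath_eq_face_iff f i γ).2 hi)
  rw [gradFun, dif_pos h, hc, boundary_unitP, Finset.sum_apply, Finset.sum_eq_single i]
  · simp [unitP]
  · intro j _ hj
    have hne : face i γ ≠ face j γ := fun he => by
      have h₁ := (fPath_eq_face_iff f i γ).2 hi
      rw [he, fPath_eq_face_iff] at h₁
      exact hj (hγ.eq_of_eq_zero hG hf h₁ hi)
    simp [unitP, hne]
  · simp

lemma gradFun_apply_eq_zero {V : Type} [Fintype V] [DecidableEq V] {G : Digraph V} {f : V → ℝ}
    (hG : G.Transitive) (hf : IsMorse G f) {n : ℕ} {α : Path V n} {γ : Path V (n + 1)}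
    (h : ∀ i, Allowed G γ → f (γ i) = 0 → face i γ ≠ α) : gradFun G f α γ = 0 := by
  by_cases hα : HasEqualCoface G f α
  · obtain ⟨δ, hδ, ⟨i, rfl⟩, hv⟩ := hα
    have hi := (fPath_eq_face_iff f i δ).1 hv
    have hne : γ ≠ δ := by
      rintro rfl
      exact h i hδ hi rfl
    simp [gradFun_face hG hf hδ hi, unitP, hne]
  · simp [gradFun_eq_zero hα]

lemma grad_apply {V : Type} [Fintype V] [DecidableEq V] (G : Digraph V) (f : V → ℝ) {n : ℕ}
    (x : Chain V n) (γ : Path V (n + 1)) : grad G f n x γ = ∑ α, x α * gradFun G f α γ := by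
  change (∑ α, x α • gradFun G f α) γ = _
  simp

/-- The chains supported on allowed paths meeting the zero set of `f`. -/
def ZeroSupported {V : Type} (G : Digraph V) (f : V → ℝ) {n : ℕ} (x : Chain V n) : Prop :=
  ∀ p, x p ≠ 0 → Allowed G p ∧ ∃ i, f (p i) = 0

lemma zeroSupported_grad {V : Type} [Fintype V] [DecidableEq V] {G : Digraph V} {f : V → ℝ}
    (hG : G.Transitive) (hf : IsMorse G f) {n : ℕ} (x : Chain V n) :
    ZeroSupported G f (grad G f n x) := by
  intro γ hγ
  by_contra hn
  refine hγ ?_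
  rw [grad_apply]
  refine Finset.sum_eq_zero fun α _ => ?_
  rw [gradFun_apply_eq_zero hG hf fun i ha hi => absurd ⟨ha, i, hi⟩ hn, mul_zero]

lemma grad_apply_of_eq_zero {V : Type} [Fintype V] [DecidableEq V] {G : Digraph V} {f : V → ℝ}
    (hG : G.Transitive) (hf : IsMorse G f) {n : ℕ} (x : Chain V n) {γ : Path V (n + 1)}
    (hγ : Allowed G γ) {i : Fin (n + 2)} (hi : f (γ i) = 0) :
    grad G f n x γ = -(-1) ^ (i : ℕ) * x (face i γ) := by
  rw [grad_apply, Finset.sum_eq_single (face i γ)]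
  · simp [gradFun_face hG hf hγ hi, unitP, mul_comm]
  · intro α _ hα
    rw [gradFun_apply_eq_zero hG hf, mul_zero]
    intro j _ hj he
    exact hα (hγ.eq_of_eq_zero hG hf hi hj ▸ he.symm)
  · simp

lemma grad_eq_zero_of_forall {V : Type} [Fintype V] [DecidableEq V] {G : Digraph V} {f : V → ℝ}
    {n : ℕ} {x : Chain V n} (hx : ∀ p, x p ≠ 0 → ¬ HasEqualCoface G f p) : grad G f n x = 0 := by
  change ∑ α, x α • gradFun G f α = 0
  refine Finset.sum_eq_zero fun α _ => ?_
  by_cases h : x α = 0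
  · rw [h, zero_smul]
  · rw [gradFun_eq_zero (hx α h), smul_zero]

lemma grad_eq_zero_of_zeroSupported {V : Type} [Fintype V] [DecidableEq V] {G : Digraph V}
    {f : V → ℝ} (hG : G.Transitive) (hf : IsMorse G f) {n : ℕ} {x : Chain V n}
    (hx : ZeroSupported G f x) : grad G f n x = 0 :=
  grad_eq_zero_of_forall fun p hp =>
    let ⟨_, hi⟩ := (hx p hp).2
    not_hasEqualCoface_of_eq_zero hG hf hi

lemma grad_boundary_unitP {V : Type} [Fintype V] [DecidableEq V] {G : Digraph V} {f : V → ℝ}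
    (hG : G.Transitive) (hf : IsMorse G f) {n : ℕ} {γ : Path V (n + 1)} (hγ : Allowed G γ)
    {i : Fin (n + 2)} (hi : f (γ i) = 0) :
    grad G f n (boundary V n (unitP γ)) = -unitP γ := by
  rw [boundary_unitP, map_sum, Finset.sum_eq_single i]
  · rw [map_smul, grad_unitP, gradFun_face hG hf hγ hi, smul_smul, mul_neg, ← pow_add,
      Even.neg_one_pow ⟨_, rfl⟩, neg_one_smul]
  · intro j _ hj
    obtain ⟨k, hk⟩ := Fin.exists_succAbove_eq hj.symm
    have h0 : f (face j γ k) = 0 := by simpa [face, hk] using hi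
    rw [map_smul, grad_unitP, gradFun_eq_zero (not_hasEqualCoface_of_eq_zero hG hf h0), smul_zero]
  · simp

/-- `V∂ = -Id` on chains supported on allowed paths meeting the zero set of `f`. -/
lemma grad_boundary_of_zeroSupported {V : Type} [Fintype V] [DecidableEq V] {G : Digraph V}
    {f : V → ℝ} (hG : G.Transitive) (hf : IsMorse G f) {n : ℕ} {x : Chain V (n + 1)}
    (hx : ZeroSupported G f x) : grad G f n (boundary V n x) = -x := by
  have hsum : x = ∑ p, x p • unitP p := by
    funext q
    simp [unitP, Finset.sum_apply, Pi.single_apply]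
  conv_lhs => rw [hsum]
  conv_rhs => rw [hsum]
  rw [map_sum, map_sum, ← Finset.sum_neg_distrib]
  refine Finset.sum_congr rfl fun p _ => ?_
  by_cases h : x p = 0
  · simp [h]
  · obtain ⟨hp, i, hi⟩ := hx p h
    rw [map_smul, map_smul, grad_boundary_unitP hG hf hp hi, smul_neg]

lemma zeroSupported_vd {V : Type} [Fintype V] [DecidableEq V] {G : Digraph V} {f : V → ℝ}
    (hG : G.Transitive) (hf : IsMorse G f) {n : ℕ} (x : Chain V n) :
    ZeroSupported G f (vd G f n x) := by
  cases n with
  | zero => exact fun p hp => absurd rfl hp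
  | succ n => exact zeroSupported_grad hG hf _

lemma vd_vd {V : Type} [Fintype V] [DecidableEq V] {G : Digraph V} {f : V → ℝ}
    (hG : G.Transitive) (hf : IsMorse G f) {n : ℕ} (x : Chain V n) :
    vd G f n (vd G f n x) = -vd G f n x := by
  cases n with
  | zero => simp [vd]
  | succ n => exact grad_boundary_of_zeroSupported hG hf (zeroSupported_grad hG hf _)

lemma IsCritical.ne_zero {V : Type} {G : Digraph V} {f : V → ℝ} (hG : G.Transitive) {n : ℕ}
    {p : Path V (n + 1)} (hp : IsCritical G f p) (i : Fin (n + 2)) : f (p i) ≠ 0 := fun hi =>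
  hp.2.2 ⟨face i p, hp.1.face hG i, ⟨i, rfl⟩, ((fPath_eq_face_iff f i p).2 hi).symm⟩

lemma vd_apply_of_isCritical {V : Type} [Fintype V] [DecidableEq V] {G : Digraph V} {f : V → ℝ}
    (hG : G.Transitive) (hf : IsMorse G f) {n : ℕ} (x : Chain V n) {p : Path V n}
    (hp : IsCritical G f p) : vd G f n x p = 0 := by
  cases n with
  | zero => rfl
  | succ n =>
    by_contra h
    obtain ⟨i, hi⟩ := (zeroSupported_vd hG hf x p h).2
    exact hp.ne_zero hG i hi

lemma flow_apply {V : Type} [Fintype V] [DecidableEq V] (G : Digraph V) (f : V → ℝ) {n : ℕ}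
    (x : Chain V n) : flow G f n x = x + boundary V n (grad G f n x) + vd G f n x := rfl

lemma mem_pPhi_iff {V : Type} [Fintype V] [DecidableEq V] (G : Digraph V) (f : V → ℝ) {n : ℕ}
    (x : Chain V n) : x ∈ pPhi G f n ↔
      x ∈ pSpan G n ∧ boundary V n (grad G f n x) + vd G f n x = 0 := by
  simp only [pPhi, Submodule.mem_inf, LinearMap.mem_ker, LinearMap.sub_apply, flow_apply,
    LinearMap.id_apply, add_assoc, add_sub_cancel_left]

/-- A flow-invariant chain without critical terms vanishes. -/
lemma eq_zero_of_mem_pPhi {V : Type} [Fintype V] [DecidableEq V] {G : Digraph V} {f : V → ℝ}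
    (hG : G.Transitive) (hf : IsMorse G f) {n : ℕ} {y : Chain V n} (hy : y ∈ pPhi G f n)
    (hcrit : ∀ p, IsCritical G f p → y p = 0) : y = 0 := by
  obtain ⟨hP, hΦ⟩ := (mem_pPhi_iff G f y).1 hy
  rw [mem_pSpan_iff] at hP
  have hV : grad G f n y = 0 := by
    have h := congrArg (grad G f n) hΦ
    rw [map_add, grad_boundary_of_zeroSupported hG hf (zeroSupported_grad hG hf y),
      grad_eq_zero_of_zeroSupported hG hf (zeroSupported_vd hG hf y), map_zero, add_zero,
      neg_eq_zero] at h
    exact h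
  rw [hV, map_zero, zero_add] at hΦ
  have hface : ∀ p, y p ≠ 0 → HasEqualFace G f n p := by
    intro p hp
    by_contra hnf
    refine hp (hcrit p ⟨hP p hp, ?_, hnf⟩)
    rintro ⟨γ, hγ, ⟨i, rfl⟩, hv⟩
    have h := grad_apply_of_eq_zero hG hf y hγ ((fPath_eq_face_iff f i γ).1 hv)
    rw [hV, Pi.zero_apply, zero_eq_mul] at h
    exact h.elim (neg_ne_zero.2 (pow_ne_zero _ (by norm_num))) hp
  cases n with
  | zero =>
    funext p
    by_contra hp
    exact hface p hp
  | succ n =>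
    have hz : ZeroSupported G f y := by
      intro p hp
      obtain ⟨_, _, ⟨i, rfl⟩, hv⟩ := hface p hp
      exact ⟨hP p hp, i, (fPath_eq_face_iff f i p).1 hv.symm⟩
    have h : -y = 0 := (grad_boundary_of_zeroSupported hG hf hz).symm.trans hΦ
    exact neg_eq_zero.1 h

lemma flow_eq_of_mem_critSpan {V : Type} [Fintype V] [DecidableEq V] {G Gbar : Digraph V}
    {f : V → ℝ} {n : ℕ} {x : Chain V n} (hx : x ∈ critSpan G Gbar f n) :
    flow Gbar f n x = x + vd Gbar f n x := by
  rw [mem_critSpan_iff] at hx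
  rw [flow_apply, grad_eq_zero_of_forall fun p hp => (hx p hp).1.2.1, map_zero, add_zero]

lemma flow_mem_omega {V : Type} [Fintype V] [DecidableEq V] {G Gbar : Digraph V} {f : V → ℝ}
    {n : ℕ} (hflow : ∀ α : Path V n, Allowed G α → IsCritical Gbar f α →
      flow Gbar f n (unitP α) ∈ omega G n)
    {x : Chain V n} (hx : x ∈ critSpan G Gbar f n) : flow Gbar f n x ∈ omega G n := by
  have hle : critSpan G Gbar f n ≤ (omega G n).comap (flow Gbar f n) := by
    refine Submodule.span_le.2 ?_
    rintro _ ⟨α, hα, hG, rfl⟩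
    exact hflow α hG hα
  exact hle hx

lemma add_vd_mem_pPhi {V : Type} [Fintype V] [DecidableEq V] {G Gbar : Digraph V} {f : V → ℝ}
    (hG : Gbar.Transitive) (hf : IsMorse Gbar f) {n : ℕ} {x : Chain V n}
    (hx : x ∈ critSpan G Gbar f n) : x + vd Gbar f n x ∈ pPhi Gbar f n := by
  rw [mem_critSpan_iff] at hx
  refine (mem_pPhi_iff _ _ _).2 ⟨Submodule.add_mem _ ?_ ?_, ?_⟩
  · exact (mem_pSpan_iff _ _).2 fun p hp => (hx p hp).1.1
  · exact (mem_pSpan_iff _ _).2 fun p hp => (zeroSupported_vd hG hf x p hp).1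
  · rw [map_add, map_add, map_add, grad_eq_zero_of_forall fun p hp => (hx p hp).1.2.1,
      grad_eq_zero_of_zeroSupported hG hf (zeroSupported_vd hG hf x), vd_vd hG hf]
    simp

/-- If `Φ̄(α) ∈ Ω(G)` for every path `α` allowed in `G` and critical in the
transitive closure `Ḡ`, then `α ↦ α + V̄∂α` is a linear isomorphism from the span of such paths
onto `P_n^Φ̄(Ḡ) ∩ Ω_n(G)`. -/
theorem stmt12 {V : Type} [Fintype V] [DecidableEq V] (G Gbar : Digraph V)
    (hcl : IsTransClosure G Gbar) (f : V → ℝ) (hf : IsMorse Gbar f)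
    (hflow : ∀ (n : ℕ) (α : Path V n), Allowed G α → IsCritical Gbar f α →
      flow Gbar f n (unitP α) ∈ omega G n)
    (n : ℕ) :
    ∃ e : ↥(critSpan G Gbar f n) ≃ₗ[ℝ] ↥(pPhi Gbar f n ⊓ omega G n),
      ∀ x : ↥(critSpan G Gbar f n),
        (e x : Chain V n) = (x : Chain V n) + vd Gbar f n (x : Chain V n) := by
  have hG := hcl.1
  have hmem : ∀ x ∈ critSpan G Gbar f n,
      x + vd Gbar f n x ∈ pPhi Gbar f n ⊓ omega G n := fun x hx =>
    ⟨add_vd_mem_pPhi hG hf hx, flow_eq_of_mem_critSpan hx ▸ flow_mem_omega (hflow n) hx⟩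
  let L : ↥(critSpan G Gbar f n) →ₗ[ℝ] ↥(pPhi Gbar f n ⊓ omega G n) :=
    (LinearMap.id + vd Gbar f n).restrict hmem
  have hL : ∀ x, (L x : Chain V n) = (x : Chain V n) + vd Gbar f n (x : Chain V n) :=
    fun _ => rfl
  have hbij : Function.Bijective L := by
    constructor
    · rw [injective_iff_map_eq_zero]
      intro x hx
      ext p
      by_contra hp
      have hcrit := ((mem_critSpan_iff G Gbar f _).1 x.2 p hp).1
      have h : (L x : Chain V n) p = 0 := by rw [hx]; rfl
      rw [hL, Pi.add_apply, vd_apply_of_isCritical hG hf _ hcrit, add_zero] at h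
      exact hp h
    · rintro ⟨x, hx⟩
      let c : Chain V n := fun p => if IsCritical Gbar f p then x p else 0
      have hxG := (mem_pSpan_iff G x).1 (omega_le_pSpan G n hx.2)
      have hc : c ∈ critSpan G Gbar f n := by
        refine (mem_critSpan_iff G Gbar f c).2 fun p hp => ?_
        by_cases h : IsCritical Gbar f p
        · exact ⟨h, hxG p (by simpa [c, h] using hp)⟩
        · simp [c, h] at hp
      refine ⟨⟨c, hc⟩, Subtype.ext ?_⟩
      rw [hL]
      refine (sub_eq_zero.1 (eq_zero_of_mem_pPhi hG hf
        (Submodule.sub_mem _ hx.1 (add_vd_mem_pPhi hG hf hc)) fun p hp => ?_)).symm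
      simp [c, hp, vd_apply_of_isCritical hG hf]
  exact ⟨LinearEquiv.ofBijective L hbij, hL⟩

end PathMorse
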